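/- arXiv:1410.7184 — 2 statements merged into one kernel-verified Lean document; each statement's English description precedes it below -/
import Mathlib

section
/- Let m, s, d be positive integers with gcd(s, m) = 1, and let f(x) = Σ_{j=0}^{d} f_j x^{q^{s j}} be a polynomial over F_{q^m} that is not identically zero (i.e., not all f_j are zero). Then f has at most q^d zeros in F_{q^m}. -/
/-- Summation by parts in the form of a factorisation through forward differences. -/
theorem sum_range_succ_mul_eq_sub_sum_diff {R : Type*} [CommRing R] (e a : ℕ → R) (n : ℕ) :
    ∑ j ∈ Finset.range (n + 1), e j * a j =
      (∑ j ∈ Finset.range (n + 1), e j) * a n -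
        ∑ j ∈ Finset.range n, (∑ i ∈ Finset.range (j + 1), e i) * (a (j + 1) - a j) := by
  induction n with
  | zero => simp
  | succ n ih =>
    rw [Finset.sum_range_succ, ih, Finset.sum_range_succ e (n + 1),
      Finset.sum_range_succ (fun j => (∑ i ∈ Finset.range (j + 1), e i) * (a (j + 1) - a j))]
    ring

/-- If all partial sums of `e` up to `n` vanish, so do all terms. -/
theorem eq_zero_of_sum_range_eq_zero {R : Type*} [AddCommGroup R] {e : ℕ → R} {n : ℕ}
    (h : ∀ j ≤ n, ∑ i ∈ Finset.range (j + 1), e i = 0) {j : ℕ} (hj : j ≤ n) : e j = 0 := by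
  have hj' := h j hj
  cases j with
  | zero => simpa using hj'
  | succ j => rwa [Finset.sum_range_succ, h j (by omega), zero_add] at hj'

/-- A nonzero skew polynomial of degree at most `d` in a field endomorphism `σ` has at most `N ^ d`
zeros, where `N` is the number of fixed points of `σ`. -/
theorem card_zeros_skew_polynomial_le {K : Type*} [Field K] [Fintype K] [DecidableEq K]
    (σ : K →+* K) (d : ℕ) (c : ℕ → K) (hc : ∃ j ≤ d, c j ≠ 0) :
    ({x | ∑ j ∈ Finset.range (d + 1), c j * σ^[j] x = 0} : Finset K).card ≤
      ({x | σ x = x} : Finset K).card ^ d := by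
  induction d generalizing c with
  | zero =>
    obtain ⟨j, hj, hcj⟩ := hc
    obtain rfl : j = 0 := by omega
    rw [pow_zero, Finset.card_le_one]
    simp [hcj]
  | succ d ih =>
    by_cases hx : ∃ x₀ : K, x₀ ≠ 0 ∧ ∑ j ∈ Finset.range (d + 1 + 1), c j * σ^[j] x₀ = 0
    · obtain ⟨x₀, hx₀, hzero⟩ := hx
      set e : ℕ → K := fun j => c j * σ^[j] x₀
      have hσ : ∀ j, σ^[j] x₀ ≠ 0 := fun j => by
        rw [← RingHom.coe_pow]; exact (map_ne_zero _).2 hx₀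
      set g : ℕ → K := fun j => ∑ i ∈ Finset.range (j + 1), e i
      have hgne : ∃ j ≤ d, g j ≠ 0 := by
        by_contra! hall
        obtain ⟨j, hj, hcj⟩ := hc
        have hej : e j = 0 := eq_zero_of_sum_range_eq_zero (n := d + 1) (fun i hi => by
          rcases Nat.lt_or_ge d i with h | h
          · obtain rfl : i = d + 1 := by omega
            exact hzero
          · exact hall i h) hj
        exact mul_ne_zero hcj (hσ j) hej
      have hfactor : ∀ z, ∑ j ∈ Finset.range (d + 1 + 1), c j * σ^[j] (x₀ * z) =
          -∑ j ∈ Finset.range (d + 1), g j * σ^[j] (σ z - z) := fun z => by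
        have h := sum_range_succ_mul_eq_sub_sum_diff e (fun j => σ^[j] z) (d + 1)
        rw [show ∑ j ∈ Finset.range (d + 1 + 1), e j = 0 from hzero, zero_mul, zero_sub] at h
        simp only [← RingHom.coe_pow, map_mul, ← mul_assoc, map_sub] at h ⊢
        simp only [RingHom.coe_pow] at h ⊢
        simpa only [Function.iterate_succ_apply] using h
      refine (Finset.card_le_mul_card_image (f := fun x => σ (x₀⁻¹ * x) - x₀⁻¹ * x) _
        ({x | σ x = x} : Finset K).card fun b _ => ?_).trans ?_
      · rcases Finset.eq_empty_or_nonempty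
          ({x ∈ ({x | ∑ j ∈ Finset.range (d + 1 + 1), c j * σ^[j] x = 0} : Finset K) |
            σ (x₀⁻¹ * x) - x₀⁻¹ * x = b}) with h | ⟨y, hy⟩
        · rw [h, Finset.card_empty]
          exact Nat.zero_le _
        · refine Finset.card_le_card_of_injOn (fun x => x₀⁻¹ * x - x₀⁻¹ * y) (fun x hx => ?_)
            fun x _ z _ hxz => by simpa [hx₀] using hxz
          have hx := (Finset.mem_filter.1 hx).2
          have hy := (Finset.mem_filter.1 hy).2
          simp only [Finset.coe_filter, Finset.mem_univ, true_and, Set.mem_ofPred_eq, map_sub]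
          linear_combination hx - hy
      · rw [pow_succ']
        refine Nat.mul_le_mul_left _ ((Finset.card_le_card fun b hb => ?_).trans (ih g hgne))
        obtain ⟨x, hx, rfl⟩ := Finset.mem_image.1 hb
        have hx := (Finset.mem_filter.1 hx).2
        have h := hfactor (x₀⁻¹ * x)
        rw [mul_inv_cancel_left₀ hx₀, hx, eq_comm, neg_eq_zero] at h
        simpa using h
    · have h0 : ∀ y ∈ ({x | ∑ j ∈ Finset.range (d + 1 + 1), c j * σ^[j] x = 0} : Finset K),
          y = 0 := fun y hy => by
        by_contra hne
        exact hx ⟨y, hne, (Finset.mem_filter.1 hy).2⟩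
      have hpos : 0 < ({x | σ x = x} : Finset K).card :=
        Finset.card_pos.2 ⟨0, Finset.mem_filter.2 ⟨Finset.mem_univ _, map_zero σ⟩⟩
      calc _ ≤ 1 := Finset.card_le_one.2 fun a ha b hb => (h0 a ha).trans (h0 b hb).symm
        _ ≤ _ := Nat.one_le_pow _ _ hpos

/-- In a finite field, the equation `x ^ q = x` with `1 < q` has at most `q` solutions. -/
theorem card_pow_eq_self_le {K : Type*} [Field K] [Fintype K] [DecidableEq K]
    {q : ℕ} (hq : 1 < q) : ({x | x ^ q = x} : Finset K).card ≤ q := by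
  have hne : (Polynomial.X ^ q - Polynomial.X : Polynomial K) ≠ 0 :=
    FiniteField.X_pow_card_sub_X_ne_zero K hq
  calc _ ≤ (Polynomial.X ^ q - Polynomial.X : Polynomial K).roots.toFinset.card :=
        Finset.card_le_card fun x hx => by
          simpa [hne, sub_eq_zero] using hx
    _ ≤ _ := Multiset.toFinset_card_le _
    _ ≤ _ := Polynomial.card_roots' _
    _ = q := FiniteField.X_pow_card_sub_X_natDegree_eq K hq

/-- Let `m, s, d` be positive integers with `gcd(s, m) = 1`, and let
`f(x) = ∑_{j=0}^{d} f_j x^{q^{s j}}` be a polynomial over `F_{q^m}` that is not identically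
zero (i.e. not all coefficients `f_j` are zero). Then `f` has at most `q^d` zeros
in `F_{q^m}`. -/
theorem zeros_of_linearized_polynomial (q m s d : ℕ) (K : Type*) [Field K] [Fintype K]
    (hK : Fintype.card K = q ^ m) (hm : 0 < m) (hs : 0 < s) (hd : 0 < d)
    (hsm : Nat.gcd s m = 1)
    (c : Fin (d + 1) → K) (hc : c ≠ 0) :
    Set.ncard {x : K | ∑ j : Fin (d + 1), c j * x ^ (q ^ (s * (j : ℕ))) = 0} ≤ q ^ d := by
  classical
  have hq : 1 < q := by
    have := hK ▸ Fintype.one_lt_card (α := K)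
    exact (Nat.one_lt_pow_iff hm.ne').1 this
  obtain ⟨p, hchar⟩ := CharP.exists K
  obtain ⟨n, hp, hn⟩ := FiniteField.card K p
  have : Fact p.Prime := ⟨hp⟩
  obtain ⟨k, -, rfl⟩ := (Nat.dvd_prime_pow hp).1
    ((dvd_pow_self q hm.ne').trans (hK.symm.trans hn).dvd)
  have hiter : ∀ (j : ℕ) (x : K), (iterateFrobenius K p (k * s))^[j] x =
      x ^ (p ^ k) ^ (s * j) := fun j x => by
    rw [← coe_iterateFrobenius_mul, iterateFrobenius_def, ← pow_mul, mul_assoc]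
  have hfixed : ∀ x : K, iterateFrobenius K p (k * s) x = x → x ^ p ^ k = x := fun x hx => by
    have h₁ : Function.IsPeriodicPt (fun y : K => y ^ p ^ k) s x := by
      rw [Function.IsPeriodicPt, Function.IsFixedPt, pow_iterate]
      rwa [iterateFrobenius_def, pow_mul] at hx
    have h₂ : Function.IsPeriodicPt (fun y : K => y ^ p ^ k) m x := by
      rw [Function.IsPeriodicPt, Function.IsFixedPt, pow_iterate, ← hK]
      exact FiniteField.pow_card x
    have h := h₁.gcd h₂
    rwa [hsm] at h
  obtain ⟨i, hi⟩ := Function.ne_iff.1 hc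
  have key := card_zeros_skew_polynomial_le (iterateFrobenius K p (k * s)) d
    (fun j => if h : j < d + 1 then c ⟨j, h⟩ else 0) ⟨i, by omega, by
      rw [dif_pos i.isLt]; exact hi⟩
  have hset : {x : K | ∑ j : Fin (d + 1), c j * x ^ ((p ^ k) ^ (s * (j : ℕ))) = 0} =
      (({x | ∑ j ∈ Finset.range (d + 1), (if h : j < d + 1 then c ⟨j, h⟩ else 0) *
        (iterateFrobenius K p (k * s))^[j] x = 0} : Finset K) : Set K) := by
    ext x
    simp only [Finset.sum_range, hiter, Fin.is_lt, dite_true, Finset.coe_filter, Finset.mem_univ,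
      true_and, Set.mem_ofPred_eq, Fin.eta]
  rw [hset, Set.ncard_coe_finset]
  refine key.trans (Nat.pow_le_pow_left ((Finset.card_le_card fun x hx => ?_).trans
    (card_pow_eq_self_le (K := K) hq)) d)
  simpa using hfixed x (Finset.mem_filter.1 hx).2
end

section
/- Let q be an odd prime power. The number of m×m symmetric matrices over F_q of rank 2s+1 and type τ equals (1/(2q^s)) · ∏_{j=0}^{2s}(q^m - q^j) / ∏_{j=0}^{s-1}(q^{2s} - q^{2j}) (in particular this count is the same for τ = 1 and τ = -1). -/
/-- An `m × m` symmetric matrix `A` over `F_q` (`q` odd) has type `τ` if either `A = 0`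
and `τ = 1` (convention), or `A` is congruent to the diagonal matrix
`diag(z, 1, …, 1, 0, …, 0)` with rank-many nonzero entries and `η(z) = τ`,
where `η` is the quadratic character. -/
def HasType {m : ℕ} (F : Type*) [Field F] [Fintype F] [DecidableEq F]
    (A : Matrix (Fin m) (Fin m) F) (τ : ℤ) : Prop :=
  (A = 0 ∧ τ = 1) ∨
    ∃ (T : Matrix (Fin m) (Fin m) F) (z : F), IsUnit T.det ∧
      (quadraticChar F z : ℤ) = τ ∧
      T.transpose * A * T
        = Matrix.diagonal (fun j : Fin m =>
            if (j : ℕ) = 0 then z else if (j : ℕ) < A.rank then 1 else 0)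

open Matrix

theorem rank_fromCols_replicateCol {F m n : Type*} [Field F] [Fintype m] [Fintype n]
    (A : Matrix m n F) (b : m → F) [Decidable (∃ x, A *ᵥ x = b)] :
    (fromCols A (replicateCol Unit b)).rank = A.rank + if ∃ x, A *ᵥ x = b then 0 else 1 := by
  have hrange : LinearMap.range (fromCols A (replicateCol Unit b)).mulVecLin =
      LinearMap.range A.mulVecLin ⊔ Submodule.span F {b} := by
    rw [range_mulVecLin, range_mulVecLin, ← Submodule.span_union]
    congr 1
    ext v
    simp [Set.mem_range, funext_iff, fromCols, replicateCol, or_comm, eq_comm]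
  have hmem : b ∈ LinearMap.range A.mulVecLin ↔ ∃ x, A *ᵥ x = b := by simp
  unfold Matrix.rank
  rw [hrange]
  split_ifs with h
  · rw [sup_eq_left.2 (by simpa using h), add_zero]
  · have hb : b ≠ 0 := by
      rintro rfl
      exact h ⟨0, by simp⟩
    have hdisj : LinearMap.range A.mulVecLin ⊓ Submodule.span F {b} = ⊥ :=
      disjoint_iff.1 ((Submodule.disjoint_span_singleton' hb).2 (hmem.not.2 h))
    have := Submodule.finrank_sup_add_finrank_inf_eq
      (LinearMap.range A.mulVecLin) (Submodule.span F {b})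
    rwa [hdisj, finrank_bot, finrank_span_singleton hb, add_zero] at this

/-- The symmetric matrix `[[A, b], [bᵀ, c]]`. -/
def bordered {F m : Type*} (A : Matrix m m F) (b : m → F) (c : F) :
    Matrix (m ⊕ Unit) (m ⊕ Unit) F :=
  fromBlocks A (replicateCol Unit b) (replicateRow Unit b) (of fun _ _ => c)

theorem transpose_bordered {F m : Type*} [Field F]
    {A : Matrix m m F} (hA : A.IsSymm) (b : m → F) (c : F) :
    (bordered A b c)ᵀ = fromCols (fromCols A (replicateCol Unit b))ᵀ
      (replicateCol Unit (Sum.elim b fun _ => c)) := by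
  ext (i | i) (j | j) <;> simp [bordered, hA.apply]

theorem rank_bordered_of_mulVec_eq {F m : Type*} [Field F] [DecidableEq F] [Fintype m]
    {A : Matrix m m F} (hA : A.IsSymm) (x : m → F) (c : F) :
    (bordered A (A *ᵥ x) c).rank = A.rank + if c = x ⬝ᵥ A *ᵥ x then 0 else 1 := by
  classical
  have hiff : (∃ y, (fromCols A (replicateCol Unit (A *ᵥ x)))ᵀ *ᵥ y =
      Sum.elim (A *ᵥ x) fun _ => c) ↔ c = x ⬝ᵥ A *ᵥ x := by
    have hsymm (y : m → F) : (A *ᵥ x) ⬝ᵥ y = x ⬝ᵥ A *ᵥ y := by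
      rw [dotProduct_mulVec, ← mulVec_transpose, hA.eq]
    have hrow (y : m → F) : replicateRow Unit (A *ᵥ x) *ᵥ y = fun _ => x ⬝ᵥ A *ᵥ y :=
      funext fun _ => hsymm y
    simp only [transpose_fromCols, fromRows_mulVec, hA.eq, transpose_replicateCol, hrow,
      Sum.elim_eq_iff]
    constructor
    · rintro ⟨y, hy, hc⟩
      rw [← hy, ← congrFun hc ()]
    · rintro rfl
      exact ⟨x, rfl, rfl⟩
  rw [← rank_transpose, transpose_bordered hA, rank_fromCols_replicateCol, rank_transpose,
    rank_fromCols_replicateCol, if_pos ⟨x, rfl⟩, add_zero]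
  simp only [hiff]

theorem rank_bordered_of_forall_ne {F m : Type*} [Field F] [Fintype m]
    {A : Matrix m m F} (hA : A.IsSymm) {b : m → F} (hb : ¬ ∃ x, A *ᵥ x = b) (c : F) :
    (bordered A b c).rank = A.rank + 2 := by
  classical
  rw [← rank_transpose, transpose_bordered hA, rank_fromCols_replicateCol, rank_transpose,
    rank_fromCols_replicateCol, if_neg hb, if_neg]
  rintro ⟨y, hy⟩
  refine hb ⟨y, ?_⟩
  ext i
  simpa [transpose_fromCols, hA.eq] using congrFun hy (Sum.inl i)

/-- Bordering identifies the symmetric matrices of size one larger with the triples `(A, b, c)`. -/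
def symmBorderedEquiv (F m : Type*) [Field F] :
    {A : Matrix m m F // A.IsSymm} × (m → F) × F ≃
      {M : Matrix (m ⊕ Unit) (m ⊕ Unit) F // M.IsSymm} where
  toFun p := ⟨bordered p.1.1 p.2.1 p.2.2, by
    refine IsSymm.ext ?_
    rintro (i | i) (j | j) <;> simp [bordered, p.1.2.apply]⟩
  invFun M := ⟨⟨M.1.toBlocks₁₁, IsSymm.ext fun i j => M.2.apply _ _⟩,
    fun i => M.1 (Sum.inl i) (Sum.inr ()), M.1 (Sum.inr ()) (Sum.inr ())⟩
  left_inv _ := rfl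
  right_inv M := by
    refine Subtype.ext (Matrix.ext ?_)
    rintro (i | i) (j | j) <;> simp [bordered, toBlocks₁₁, M.2.apply]

/-- The number of symmetric matrices of rank `r`. -/
noncomputable def symmRankCount (F m : Type*) [Field F] [Fintype m] (r : ℕ) : ℕ :=
  Set.ncard {A : Matrix m m F | A.IsSymm ∧ A.rank = r}

theorem symmRankCount_congr {F m n : Type*} [Field F] [Fintype m] [Fintype n] (e : m ≃ n)
    (r : ℕ) : symmRankCount F m r = symmRankCount F n r := by
  refine Set.ncard_congr' ((reindex e e).subtypeEquiv fun A => ?_)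
  simp only [Set.mem_ofPred_eq, rank_reindex]
  refine and_congr_left fun _ => ⟨fun h => ?_, fun h => ?_⟩
  · exact h.submatrix _
  · simpa using h.submatrix e

theorem symmRankCount_eq_sum {F m : Type*} [Field F] [Fintype F] [Fintype m]
    [Fintype {A : Matrix m m F // A.IsSymm}] (r : ℕ) :
    (symmRankCount F m r : ℤ) =
      ∑ A : {A : Matrix m m F // A.IsSymm}, if A.1.rank = r then 1 else 0 := by
  classical
  rw [Finset.sum_boole, symmRankCount, ← Fintype.card_subtype, ← Nat.card_eq_fintype_card]
  exact congrArg _ (Nat.card_congr (Equiv.subtypeSubtypeEquivSubtypeInter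
    (fun A : Matrix m m F => A.IsSymm) fun A => A.rank = r).symm)

theorem sum_rank_bordered {F m : Type*} [Field F] [Fintype F] [Fintype m] [DecidableEq m]
    {A : Matrix m m F} (hA : A.IsSymm) (r : ℕ) :
    (∑ b : m → F, ∑ c : F, if (bordered A b c).rank = r then (1 : ℤ) else 0) =
      (Fintype.card F : ℤ) ^ A.rank * (if A.rank = r then 1 else 0) +
      (Fintype.card F : ℤ) ^ A.rank * (Fintype.card F - 1) * (if A.rank + 1 = r then 1 else 0) +
      ((Fintype.card F : ℤ) ^ Fintype.card m - (Fintype.card F : ℤ) ^ A.rank) * Fintype.card F *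
        (if A.rank + 2 = r then 1 else 0) := by
  classical
  have hcard : (Finset.univ.filter fun b => ∃ x, A *ᵥ x = b).card =
      Fintype.card F ^ A.rank := by
    rw [← Fintype.card_subtype, ← Nat.card_eq_fintype_card, ← Nat.card_eq_fintype_card]
    exact Module.natCard_eq_pow_finrank (K := F) (V := LinearMap.range A.mulVecLin)
  have hcompl : ((Finset.univ.filter fun b => ¬ ∃ x, A *ᵥ x = b).card : ℤ) =
      (Fintype.card F : ℤ) ^ Fintype.card m - (Fintype.card F : ℤ) ^ A.rank := by
    have := Finset.card_filter_add_card_filter_not (s := (Finset.univ : Finset (m → F)))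
      (fun b => ∃ x, A *ᵥ x = b)
    rw [hcard, Finset.card_univ, Fintype.card_fun] at this
    rw [← Nat.cast_pow, ← Nat.cast_pow, ← this]
    push_cast
    ring
  have hsum (x : m → F) : (∑ c : F, if (bordered A (A *ᵥ x) c).rank = r then (1 : ℤ) else 0) =
      (if A.rank = r then 1 else 0) +
        (Fintype.card F - 1) * (if A.rank + 1 = r then 1 else 0) := by
    rw [← Finset.add_sum_erase _ _ (Finset.mem_univ (x ⬝ᵥ A *ᵥ x))]
    congr 1
    · simp [rank_bordered_of_mulVec_eq hA]
    · rw [Finset.sum_congr rfl fun c hc => by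
        rw [rank_bordered_of_mulVec_eq hA, if_neg (Finset.ne_of_mem_erase hc)],
        Finset.sum_const, Finset.card_erase_of_mem (Finset.mem_univ _), Finset.card_univ,
        nsmul_eq_mul, Nat.cast_pred Fintype.card_pos]
  rw [← Finset.sum_filter_add_sum_filter_not _ fun b => ∃ x, A *ᵥ x = b]
  rw [Finset.sum_congr rfl (g := fun _ => (if A.rank = r then (1 : ℤ) else 0) +
        (Fintype.card F - 1) * (if A.rank + 1 = r then 1 else 0))
      (by rintro b hb; obtain ⟨x, rfl⟩ := (Finset.mem_filter.1 hb).2; exact hsum x),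
    Finset.sum_congr rfl (s₁ := Finset.univ.filter fun b => ¬ ∃ x, A *ᵥ x = b)
      (g := fun _ => (Fintype.card F : ℤ) * (if A.rank + 2 = r then 1 else 0))
      (by
        intro b hb
        simp only [rank_bordered_of_forall_ne hA (Finset.mem_filter.1 hb).2]
        rw [Finset.sum_const, Finset.card_univ, nsmul_eq_mul]),
    Finset.sum_const, Finset.sum_const, nsmul_eq_mul, nsmul_eq_mul, hcompl, hcard]
  push_cast
  ring

theorem symmRankCount_succ_eq_sum (F : Type*) [Field F] [Fintype F] (n r : ℕ)
    [Fintype {A : Matrix (Fin n) (Fin n) F // A.IsSymm}] :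
    (symmRankCount F (Fin (n + 1)) r : ℤ) =
      ∑ A : {A : Matrix (Fin n) (Fin n) F // A.IsSymm}, (
      (Fintype.card F : ℤ) ^ A.1.rank * (if A.1.rank = r then 1 else 0) +
      (Fintype.card F : ℤ) ^ A.1.rank * (Fintype.card F - 1) *
        (if A.1.rank + 1 = r then 1 else 0) +
      ((Fintype.card F : ℤ) ^ n - (Fintype.card F : ℤ) ^ A.1.rank) * Fintype.card F *
        (if A.1.rank + 2 = r then 1 else 0)) := by
  classical
  rw [symmRankCount_congr (Fintype.equivOfCardEq (β := Fin n ⊕ Unit) (by simp)),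
    symmRankCount_eq_sum, ← (symmBorderedEquiv F (Fin n)).sum_comp, Fintype.sum_prod_type]
  refine Finset.sum_congr rfl fun A _ => ?_
  rw [Fintype.sum_prod_type]
  have h := sum_rank_bordered A.2 r
  rw [Fintype.card_fin] at h
  exact h

theorem sum_symm_mul_ite {F : Type*} [Field F] [Fintype F] {n : ℕ}
    [Fintype {A : Matrix (Fin n) (Fin n) F // A.IsSymm}] (f : ℕ → ℤ) (k r : ℕ) :
    (∑ A : {A : Matrix (Fin n) (Fin n) F // A.IsSymm},
      f A.1.rank * if A.1.rank + k = r + k then 1 else 0) =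
      f r * symmRankCount F (Fin n) r := by
  rw [symmRankCount_eq_sum, Finset.mul_sum]
  refine Finset.sum_congr rfl fun A _ => ?_
  by_cases h : A.1.rank = r <;> simp [h]

theorem symmRankCount_succ_zero (F : Type*) [Field F] [Fintype F] (n : ℕ) :
    (symmRankCount F (Fin (n + 1)) 0 : ℤ) = symmRankCount F (Fin n) 0 := by
  classical
  rw [symmRankCount_succ_eq_sum]
  have h := sum_symm_mul_ite (F := F) (n := n) (fun j => (Fintype.card F : ℤ) ^ j) 0 0
  simpa using h

theorem symmRankCount_succ_one (F : Type*) [Field F] [Fintype F] (n : ℕ) :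
    (symmRankCount F (Fin (n + 1)) 1 : ℤ) =
      Fintype.card F * symmRankCount F (Fin n) 1 +
        (Fintype.card F - 1) * symmRankCount F (Fin n) 0 := by
  classical
  rw [symmRankCount_succ_eq_sum]
  have h := sum_symm_mul_ite (F := F) (n := n) (fun j => (Fintype.card F : ℤ) ^ j) 0 1
  have h' := sum_symm_mul_ite (F := F) (n := n)
    (fun j => (Fintype.card F : ℤ) ^ j * (Fintype.card F - 1)) 1 0
  simp only [Finset.sum_add_distrib]
  simp at h h' ⊢
  rw [h, h']

theorem symmRankCount_succ_add_two (F : Type*) [Field F] [Fintype F] (n r : ℕ) :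
    (symmRankCount F (Fin (n + 1)) (r + 2) : ℤ) =
      (Fintype.card F : ℤ) ^ (r + 2) * symmRankCount F (Fin n) (r + 2) +
      (Fintype.card F : ℤ) ^ (r + 1) * (Fintype.card F - 1) * symmRankCount F (Fin n) (r + 1) +
      ((Fintype.card F : ℤ) ^ n - (Fintype.card F : ℤ) ^ r) * Fintype.card F *
        symmRankCount F (Fin n) r := by
  classical
  rw [symmRankCount_succ_eq_sum, Finset.sum_add_distrib, Finset.sum_add_distrib]
  exact congrArg₂ _ (congrArg₂ _
    (sum_symm_mul_ite (F := F) (n := n) (fun j => (Fintype.card F : ℤ) ^ j) 0 (r + 2))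
    (sum_symm_mul_ite (F := F) (n := n)
      (fun j => (Fintype.card F : ℤ) ^ j * (Fintype.card F - 1)) 1 (r + 1)))
    (sum_symm_mul_ite (F := F) (n := n)
      (fun j => ((Fintype.card F : ℤ) ^ n - (Fintype.card F : ℤ) ^ j) * Fintype.card F) 2 r)

/-- The product `∏_{j < s} (q^{2s} - q^{2j})`. -/
def evenProd (q : ℤ) (s : ℕ) : ℤ := ∏ j ∈ Finset.range s, (q ^ (2 * s) - q ^ (2 * j))

theorem evenProd_succ (q : ℤ) (s : ℕ) :
    evenProd q (s + 1) = (q ^ (2 * s + 2) - 1) * q ^ (2 * s) * evenProd q s := by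
  have h : ∀ j, q ^ (2 * (s + 1)) - q ^ (2 * (j + 1)) = q ^ 2 * (q ^ (2 * s) - q ^ (2 * j)) := by
    intro j; ring
  simp only [evenProd, Finset.prod_range_succ', h, Finset.prod_mul_distrib, Finset.prod_const,
    Finset.card_range]
  ring

theorem prod_pow_succ_sub_pow (q : ℤ) (n r : ℕ) :
    ∏ j ∈ Finset.range (r + 1), (q ^ (n + 1) - q ^ j) =
      (q ^ (n + 1) - 1) * q ^ r * ∏ j ∈ Finset.range r, (q ^ n - q ^ j) := by
  have h : ∀ j, q ^ (n + 1) - q ^ (j + 1) = q * (q ^ n - q ^ j) := by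
    intro j; ring
  simp only [Finset.prod_range_succ', h, Finset.prod_mul_distrib, Finset.prod_const,
    Finset.card_range]
  ring

theorem symmRankCount_fin_zero (F : Type*) [Field F] (r : ℕ) :
    symmRankCount F (Fin 0) r = if r = 0 then 1 else 0 := by
  have hrank (A : Matrix (Fin 0) (Fin 0) F) : A.rank = 0 :=
    Nat.le_zero.1 (A.rank_le_width)
  split_ifs with h
  · subst h
    refine Set.ncard_eq_one.2 ⟨0, Set.ext fun A => ?_⟩
    simp [hrank, Subsingleton.elim A 0]
  · simp [symmRankCount, hrank, Ne.symm h]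

theorem symmRankCount_mul_evenProd (F : Type*) [Field F] [Fintype F] (n : ℕ) (s : ℕ) :
    (symmRankCount F (Fin n) (2 * s) : ℤ) * evenProd (Fintype.card F) s =
        (Fintype.card F : ℤ) ^ s *
          ∏ j ∈ Finset.range (2 * s), ((Fintype.card F : ℤ) ^ n - (Fintype.card F : ℤ) ^ j) ∧
      (Fintype.card F : ℤ) ^ s * evenProd (Fintype.card F) s *
          symmRankCount F (Fin n) (2 * s + 1) =
        ∏ j ∈ Finset.range (2 * s + 1),
          ((Fintype.card F : ℤ) ^ n - (Fintype.card F : ℤ) ^ j) := by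
  induction n generalizing s with
  | zero =>
    have h : ∀ r, ∏ j ∈ Finset.range (r + 1),
        ((Fintype.card F : ℤ) ^ 0 - (Fintype.card F : ℤ) ^ j) = 0 := fun r =>
      Finset.prod_eq_zero (Finset.mem_range.2 r.succ_pos) (by simp)
    refine ⟨?_, ?_⟩
    · cases s with
      | zero => simp [symmRankCount_fin_zero, evenProd]
      | succ s => rw [show 2 * (s + 1) = 2 * s + 1 + 1 by ring, h]; simp [symmRankCount_fin_zero]
    · rw [h]; simp [symmRankCount_fin_zero]
  | succ n ih =>
    obtain ⟨q, hq⟩ : ∃ q : ℤ, (Fintype.card F : ℤ) = q := ⟨_, rfl⟩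
    simp only [hq] at ih ⊢
    cases s with
    | zero =>
      have h0 := (ih 0).1
      have h1 := (ih 0).2
      simp [evenProd] at h0 h1
      simp [evenProd, symmRankCount_succ_zero, symmRankCount_succ_one, h0, h1, hq]
      ring
    | succ s =>
      obtain ⟨h0, h1⟩ := ih s
      obtain ⟨h2, h3⟩ := ih (s + 1)
      have e1 : 2 * (s + 1) + 1 = 2 * s + 1 + 2 := rfl
      have e2 : 2 * (s + 1) = 2 * s + 2 := rfl
      rw [e1] at h3 ⊢
      rw [e2] at h2 ⊢
      rw [symmRankCount_succ_add_two, symmRankCount_succ_add_two, hq, prod_pow_succ_sub_pow,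
        prod_pow_succ_sub_pow, evenProd_succ]
      rw [evenProd_succ] at h2 h3
      simp only [Finset.prod_range_succ] at h0 h1 h2 h3 ⊢
      constructor
      · linear_combination q ^ (2 * s + 2) * h2 +
          q ^ (2 * s + 1) * (q - 1) * (q ^ (2 * s + 2) - 1) * q ^ s * h1 +
          (q ^ n - q ^ (2 * s)) * q * (q ^ (2 * s + 2) - 1) * q ^ (2 * s) * h0
      · linear_combination q ^ (2 * s + 3) * h3 +
          q ^ (s + 1) * q ^ (2 * s + 2) * (q - 1) * h2 +
          (q ^ n - q ^ (2 * s + 1)) * q * q * (q ^ (2 * s + 2) - 1) * q ^ (2 * s) * h1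

/-- Congruence of square matrices. -/
def IsCongr {F m : Type*} [Field F] [Fintype m] [DecidableEq m] (A B : Matrix m m F) : Prop :=
  ∃ T : Matrix m m F, IsUnit T.det ∧ Tᵀ * A * T = B

namespace IsCongr

variable {F m : Type*} [Field F] [Fintype m] [DecidableEq m] {A B C : Matrix m m F}

theorem refl (A : Matrix m m F) : IsCongr A A := ⟨1, by simp, by simp⟩

theorem trans (h : IsCongr A B) (h' : IsCongr B C) : IsCongr A C := by
  obtain ⟨T, hT, rfl⟩ := h
  obtain ⟨U, hU, rfl⟩ := h'
  exact ⟨T * U, by rw [det_mul]; exact hT.mul hU, by simp only [transpose_mul, Matrix.mul_assoc]⟩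

theorem symm (h : IsCongr A B) : IsCongr B A := by
  obtain ⟨T, hT, rfl⟩ := h
  refine ⟨T⁻¹, isUnit_nonsing_inv_det T hT, ?_⟩
  rw [Matrix.mul_assoc, Matrix.mul_assoc, mul_nonsing_inv T hT, Matrix.mul_one, transpose_nonsing_inv,
    ← Matrix.mul_assoc, nonsing_inv_mul _ (by rwa [det_transpose]), Matrix.one_mul]

theorem rank_eq (h : IsCongr A B) : A.rank = B.rank := by
  obtain ⟨T, hT, rfl⟩ := h
  rw [rank_mul_eq_left_of_isUnit_det _ _ hT,
    rank_mul_eq_right_of_isUnit_det _ _ (by rwa [det_transpose])]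

theorem smul (c : F) (h : IsCongr A B) : IsCongr (c • A) (c • B) := by
  obtain ⟨T, hT, rfl⟩ := h
  exact ⟨T, hT, by simp⟩

theorem diagonal_comp (d : m → F) (σ : Equiv.Perm m) :
    IsCongr (diagonal d) (diagonal (d ∘ σ)) := by
  refine ⟨(1 : Matrix m m F).submatrix id σ, ?_, ?_⟩
  · rw [det_permute', det_one, mul_one]
    exact (Units.isUnit _).map (Int.castRingHom F)
  · ext i j
    by_cases h : i = j <;> simp [Matrix.mul_apply, diagonal_apply, one_apply, h]

end IsCongr

theorem ringChar_ne_two_of_odd_card {F : Type*} [Field F] [Fintype F]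
    (hF : Odd (Fintype.card F)) : ringChar F ≠ 2 := fun h =>
  Nat.not_even_iff_odd.2 hF (Nat.even_iff.2 (FiniteField.even_card_of_char_two h))

theorem exists_isCongr_diagonal {F : Type*} [Field F] (h2 : (2 : F) ≠ 0) {n : ℕ}
    {A : Matrix (Fin n) (Fin n) F} (hA : A.IsSymm) : ∃ d, IsCongr A (diagonal d) := by
  have := invertibleOfNonzero h2
  obtain ⟨v, hv⟩ := LinearMap.BilinForm.exists_orthogonal_basis
    (B := A.toBilin') (LinearMap.BilinForm.isSymm_iff.1 (isSymm_toBilin'_iff_isSymm.2 hA))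
  let e : Fin (Module.finrank F (Fin n → F)) ≃ Fin n := finCongr (by simp)
  let w := v.reindex e
  refine ⟨fun i => A.toBilin' (w i) (w i), (Pi.basisFun F (Fin n)).toMatrix w, ?_, ?_⟩
  · have := (Pi.basisFun F (Fin n)).invertibleToMatrix w
    exact isUnit_det_of_invertible _
  · have h := LinearMap.BilinForm.toMatrix_mul_basis_toMatrix (Pi.basisFun F (Fin n)) w A.toBilin'
    rw [LinearMap.BilinForm.toMatrix_basisFun, LinearMap.BilinForm.toMatrix'_toBilin'] at h
    rw [h]
    ext i j
    rw [LinearMap.BilinForm.toMatrix_apply]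
    by_cases hij : i = j
    · subst hij; simp
    · rw [diagonal_apply_ne _ hij]
      simpa [w] using hv (fun h => hij (e.symm.injective h))

open Polynomial in
theorem exists_mul_sq_add_mul_sq_eq_one {F : Type*} [Field F] [Fintype F]
    (hF : Odd (Fintype.card F)) {a b : F} (ha : a ≠ 0) (hb : b ≠ 0) :
    ∃ x y, a * x ^ 2 + b * y ^ 2 = 1 := by
  have hX : (C b * X ^ 2).degree = 2 := degree_C_mul_X_pow 2 hb
  have hg : (C b * X ^ 2 - C 1).degree = 2 := by
    rw [degree_sub_C] <;> rw [hX]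
    exact Nat.cast_pos.2 two_pos
  obtain ⟨x, y, h⟩ := FiniteField.exists_root_sum_quadratic (R := F) (f := C a * X ^ 2)
    (g := C b * X ^ 2 - C 1) (degree_C_mul_X_pow 2 ha)
    hg
    (Nat.odd_iff.1 hF)
  refine ⟨x, y, ?_⟩
  simp at h
  linear_combination h

section Diagonal

variable {F m : Type*} [Field F] [Fintype F] [Fintype m] [DecidableEq m]

theorem isCongr_diagonal_update (hF : Odd (Fintype.card F)) {d : m → F} {i j : m} (hij : i ≠ j)
    (hi : d i ≠ 0) (hj : d j ≠ 0) :
    IsCongr (diagonal d)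
      (diagonal (Function.update (Function.update d j 1) i (d i * d j))) := by
  obtain ⟨x, y, hxy⟩ := exists_mul_sq_add_mul_sq_eq_one hF hi hj
  let U : Matrix m m F := of fun k l =>
    if l = i then (if k = i then -(d j * y) else if k = j then d i * x else 0)
    else if l = j then (if k = i then x else if k = j then y else 0)
    else if k = l then 1 else 0
  have key (f : m → F) (hfi : f i = d i) (hfj : f j = d j) : Uᵀ * diagonal f * U =
      diagonal (Function.update (Function.update f j 1) i (d i * d j)) := by
    have hs (α β : F) (g : m → F) :
        ∑ k, (if k = i then α else if k = j then β else 0) * g k = α * g i + β * g j := by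
      rw [Finset.sum_eq_add_of_mem i j (Finset.mem_univ _) (Finset.mem_univ _) hij]
      · simp [hij.symm]
      · rintro k - ⟨h1, h2⟩
        simp [h1, h2]
    have hUi (g : m → F) : ∑ k, U k i * g k = -(d j * y) * g i + d i * x * g j := by
      rw [← hs]; simp [U]
    have hUj (g : m → F) : ∑ k, U k j * g k = x * g i + y * g j := by
      rw [← hs]; simp [U, hij.symm]
    have hU (l : m) (hl : l ≠ i) (hl' : l ≠ j) (g : m → F) : ∑ k, U k l * g k = g l := by
      simp [U, hl, hl']
    ext k l
    simp only [Matrix.mul_apply (M := Uᵀ * _), mul_diagonal, transpose_apply, mul_assoc]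
    by_cases hki : k = i
    · subst hki
      rw [hUi, hfi, hfj]
      by_cases hlk : l = k
      · subst hlk
        simp [U, hij.symm]
        linear_combination d l * d j * hxy
      by_cases hlj : l = j
      · subst hlj
        simp [U, hij, hij.symm]
        ring
      simp [U, hlk, hlj, Ne.symm hlk, Ne.symm hlj]
    by_cases hkj : k = j
    · subst hkj
      rw [hUj, hfi, hfj]
      by_cases hli : l = i
      · subst hli
        simp [U, hij.symm]
        ring
      by_cases hlk : l = k
      · subst hlk
        simp [U, hij.symm]
        linear_combination hxy
      simp [U, hli, hlk, Ne.symm hli, Ne.symm hlk]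
    rw [hU k hki hkj]
    by_cases hli : l = i
    · subst hli; simp [U, hki, hkj]
    by_cases hlj : l = j
    · subst hlj; simp [U, hki, hkj]
    by_cases hkl : k = l
    · subst hkl; simp [U, hki, hkj]
    simp [U, hli, hlj, hkl]
  refine ⟨U, ?_, key d rfl rfl⟩
  have h := congrArg det (key (fun k => if k = i ∨ k = j then d k else 1) (by simp) (by simp))
  rw [det_mul, det_mul, det_diagonal, det_diagonal] at h
  refine isUnit_iff_ne_zero.2 fun h0 => ?_
  rw [h0, mul_zero] at h
  refine (Finset.prod_ne_zero_iff.2 fun k _ => ?_) h.symm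
  by_cases hki : k = i
  · subst hki; simp [hi, hj]
  by_cases hkj : k = j
  · subst hkj; simp [hki]
  simp [hki, hkj]

theorem exists_isCongr_diagonal_ite (hF : Odd (Fintype.card F)) [DecidableEq F] (d : m → F)
    {i : m} (hi : d i ≠ 0) : ∃ z, z ≠ 0 ∧ IsCongr (diagonal d)
      (diagonal fun j => if j = i then z else if d j = 0 then 0 else 1) := by
  suffices h : ∀ s : Finset m, ∃ z, z ≠ 0 ∧ IsCongr (diagonal d) (diagonal fun j =>
      if j = i then z else if j ∈ s then (if d j = 0 then 0 else 1) else d j) by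
    simpa using h Finset.univ
  intro s
  induction s using Finset.induction_on with
  | empty =>
    refine ⟨d i, hi, ?_⟩
    convert IsCongr.refl (diagonal d) using 3 with j
    aesop
  | insert k s hk ih =>
    obtain ⟨z, hz, h⟩ := ih
    by_cases hki : k = i
    · refine ⟨z, hz, ?_⟩
      convert h using 3 with j
      by_cases hj : j = k <;> simp_all
    by_cases hdk : d k = 0
    · refine ⟨z, hz, ?_⟩
      convert h using 3 with j
      by_cases hj : j = k <;> simp_all
    · refine ⟨z * d k, mul_ne_zero hz hdk, h.trans ?_⟩
      have := isCongr_diagonal_update hF (d := fun j =>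
        if j = i then z else if j ∈ s then (if d j = 0 then 0 else 1) else d j)
        (i := i) (j := k) (Ne.symm hki) (by simpa) (by simp_all)
      convert this using 3 with j
      by_cases hji : j = i
      · subst hji; simp [hki, hk]
      · by_cases hj : j = k <;> simp_all

end Diagonal

/-- The diagonal matrix `diag(z, 1, …, 1, 0, …, 0)` with `r` nonzero entries if `z ≠ 0 < r`. -/
def typeDiagonal {F : Type*} [Field F] (n r : ℕ) (z : F) : Matrix (Fin n) (Fin n) F :=
  diagonal fun j : Fin n => if (j : ℕ) = 0 then z else if (j : ℕ) < r then 1 else 0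

theorem exists_isCongr_typeDiagonal {F : Type*} [Field F] [Fintype F]
    (hF : Odd (Fintype.card F)) {n : ℕ} {A : Matrix (Fin n) (Fin n) F} (hA : A.IsSymm)
    (hr : 0 < A.rank) : ∃ z, z ≠ 0 ∧ IsCongr A (typeDiagonal n A.rank z) := by
  classical
  have h2 : (2 : F) ≠ 0 := Ring.two_ne_zero (ringChar_ne_two_of_odd_card hF)
  obtain ⟨d, hd⟩ := exists_isCongr_diagonal h2 hA
  have hn : A.rank ≤ n := A.rank_le_width
  have hcard : Fintype.card {j : Fin n // (j : ℕ) < A.rank} = Fintype.card {j // d j ≠ 0} := by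
    rw [← rank_diagonal, ← hd.rank_eq]
    simp [Fintype.card_subtype, Fin.card_filter_val_lt, hn]
  let e := Fintype.equivOfCardEq hcard
  have hmem (j : Fin n) : d (e.extendSubtype j) = 0 ↔ ¬ (j : ℕ) < A.rank := by
    refine ⟨fun h hj => e.extendSubtype_mem j hj h, fun hj => ?_⟩
    simpa using e.extendSubtype_not_mem j hj
  have hn0 : 0 < n := hr.trans_le hn
  obtain ⟨z, hz, h⟩ := exists_isCongr_diagonal_ite hF (d ∘ e.extendSubtype) (i := ⟨0, hn0⟩)
    (by simpa [hmem] using hr.ne')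
  refine ⟨z, hz, (hd.trans (IsCongr.diagonal_comp d e.extendSubtype)).trans ?_⟩
  convert h using 1
  rw [typeDiagonal]
  congr! 2 with j
  simp only [hmem, Fin.ext_iff, Function.comp_apply, ite_not]

/-- The determinant of the leading `r × r` block is a congruence invariant modulo squares
for diagonal matrices vanishing outside that block. -/
theorem IsCongr.exists_sq_mul_prod_eq {F : Type*} [Field F] {n r : ℕ} {d d' : Fin n → F}
    (h : IsCongr (diagonal d) (diagonal d')) (hd : ∀ j : Fin n, r ≤ j → d j = 0) :
    ∃ u, u ^ 2 * ∏ j : {j : Fin n // (j : ℕ) < r}, d j =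
      ∏ j : {j : Fin n // (j : ℕ) < r}, d' j := by
  obtain ⟨T, -, hT⟩ := h
  let P : Matrix {j : Fin n // (j : ℕ) < r} {j : Fin n // (j : ℕ) < r} F :=
    T.submatrix Subtype.val Subtype.val
  have hP : Pᵀ * diagonal (fun j => d j.1) * P = diagonal fun j => d' j.1 := by
    ext i j
    have hij := congrFun₂ hT i.1 j.1
    have hdiag : diagonal d' i.1 j.1 = diagonal (fun j : {j : Fin n // (j : ℕ) < r} => d' j.1) i j := by
      simp [diagonal_apply, Subtype.ext_iff]
    rw [← hdiag, ← hij]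
    simp only [Matrix.mul_apply (M := Tᵀ * _), Matrix.mul_apply (M := Pᵀ * _), mul_diagonal,
      transpose_apply]
    symm
    refine Finset.sum_congr_set {j : Fin n | (j : ℕ) < r} _ _ (fun _ _ => rfl) fun x hx => ?_
    rw [hd x (not_lt.1 hx), mul_zero, zero_mul]
  refine ⟨P.det, ?_⟩
  have := congrArg det hP
  rw [det_mul, det_mul, det_transpose, det_diagonal, det_diagonal] at this
  rw [← this]
  ring

theorem hasType_iff {F : Type*} [Field F] [Fintype F] [DecidableEq F] {n : ℕ}
    {A : Matrix (Fin n) (Fin n) F} (hr : 0 < A.rank) (τ : ℤ) :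
    HasType F A τ ↔ ∃ z, quadraticChar F z = τ ∧ IsCongr A (typeDiagonal n A.rank z) := by
  have hA : A ≠ 0 := by
    rintro rfl
    simp at hr
  simp only [HasType, hA, false_and, false_or, IsCongr, typeDiagonal]
  exact ⟨fun ⟨T, z, h1, h2, h3⟩ => ⟨z, h2, T, h1, h3⟩, fun ⟨z, h2, T, h1, h3⟩ => ⟨T, z, h1, h2, h3⟩⟩

theorem prod_type_entries {F : Type*} [Field F] {n r : ℕ} (hr : 0 < r) (hn : r ≤ n) (z : F) :
    ∏ j : {j : Fin n // (j : ℕ) < r},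
      (if (j.1 : ℕ) = 0 then z else if (j.1 : ℕ) < r then 1 else 0) = z := by
  rw [Finset.prod_eq_single_of_mem ⟨⟨0, hr.trans_le hn⟩, hr⟩ (Finset.mem_univ _)]
  · simp
  · rintro ⟨j, hj⟩ - hj0
    have : (j : ℕ) ≠ 0 := fun h => hj0 (Subtype.ext (Fin.ext h))
    simp [this, hj]

/-- Congruent normal forms, up to a scalar of odd rank, have types related by the scalar. -/
theorem quadraticChar_eq_of_isCongr_smul {F : Type*} [Field F] [Fintype F] [DecidableEq F]
    {n r : ℕ} (hr : Odd r) (hn : r ≤ n) {c z z' : F} (hz' : z' ≠ 0)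
    (h : IsCongr (c • typeDiagonal n r z) (typeDiagonal n r z')) :
    quadraticChar F z' = quadraticChar F c ^ r * quadraticChar F z := by
  rw [typeDiagonal, ← diagonal_smul] at h
  obtain ⟨u, hu⟩ := h.exists_sq_mul_prod_eq (r := r) (by
    intro j hj
    have h0 : (j : ℕ) ≠ 0 := (hr.pos.trans_le hj).ne'
    simp [h0, hj])
  simp only [Pi.smul_apply, smul_eq_mul, Finset.prod_mul_distrib,
    prod_type_entries hr.pos hn, Finset.prod_const] at hu
  have hcard : (Finset.univ : Finset {j : Fin n // (j : ℕ) < r}).card = r := by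
    rw [Finset.card_univ]
    simp [Fintype.card_subtype, Fin.card_filter_val_lt, hn]
  rw [hcard] at hu
  have hu0 : u ≠ 0 := by
    rintro rfl
    exact hz' (by simp [← hu])
  rw [← hu, map_mul, quadraticChar_sq_one' hu0, map_mul, map_pow, one_mul]

/-- Symmetric matrices of given rank and type. -/
def symmRankTypeSet (F : Type*) [Field F] [Fintype F] [DecidableEq F] (n r : ℕ) (τ : ℤ) :
    Set (Matrix (Fin n) (Fin n) F) :=
  {A | A.IsSymm ∧ A.rank = r ∧ HasType F A τ}

section Count

variable {F : Type*} [Field F] [Fintype F] [DecidableEq F] {n r : ℕ}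

theorem smul_mem_symmRankTypeSet (hF : Odd (Fintype.card F)) (hr : Odd r) {c : F}
    (hc : quadraticChar F c = -1) {τ : ℤ} {A : Matrix (Fin n) (Fin n) F}
    (hA : A ∈ symmRankTypeSet F n r τ) : c • A ∈ symmRankTypeSet F n r (-τ) := by
  obtain ⟨hs, hAr, ht⟩ := hA
  have hc0 : c ≠ 0 := by
    rintro rfl
    simp at hc
  have hs' : (c • A).IsSymm := hs.smul c
  have hcr : (c • A).rank = r := by
    rw [rank_smul_of_mem_nonZeroDivisors _ (mem_nonZeroDivisors_of_ne_zero hc0), hAr]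
  have hpos : 0 < r := hr.pos
  refine ⟨hs', hcr, ?_⟩
  obtain ⟨z', hz', h'⟩ := exists_isCongr_typeDiagonal hF hs' (hcr ▸ hpos)
  obtain ⟨z, hz, h⟩ := (hasType_iff (hAr ▸ hpos) τ).1 ht
  refine (hasType_iff (hcr ▸ hpos) _).2 ⟨z', ?_, h'⟩
  rw [hcr] at h'
  rw [hAr] at h
  rw [quadraticChar_eq_of_isCongr_smul hr (hAr ▸ A.rank_le_width) hz' ((h.smul c).symm.trans h'),
    hc, hr.neg_one_pow, hz, neg_one_mul]

theorem ncard_symmRankTypeSet_neg (hF : Odd (Fintype.card F)) (hr : Odd r) (τ : ℤ) :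
    (symmRankTypeSet F n r (-τ)).ncard = (symmRankTypeSet F n r τ).ncard := by
  obtain ⟨c, hc⟩ := quadraticChar_exists_neg_one (F := F) (ringChar_ne_two_of_odd_card hF)
  have hc0 : c ≠ 0 := by
    rintro rfl
    simp at hc
  have hle (τ : ℤ) : (symmRankTypeSet F n r τ).ncard ≤ (symmRankTypeSet F n r (-τ)).ncard :=
    Set.ncard_le_ncard_of_injOn (c • ·) (fun A hA => smul_mem_symmRankTypeSet hF hr hc hA)
      (smul_right_injective _ hc0).injOn
  exact le_antisymm (by simpa using hle (-τ)) (hle τ)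

theorem ncard_symmRankTypeSet_add (hF : Odd (Fintype.card F)) (hr : Odd r) :
    (symmRankTypeSet F n r 1).ncard + (symmRankTypeSet F n r (-1)).ncard =
      symmRankCount F (Fin n) r := by
  rw [← Set.ncard_union_eq, symmRankCount]
  · congr 1
    ext A
    refine ⟨?_, fun ⟨hs, hAr⟩ => ?_⟩
    · rintro (h | h) <;> exact ⟨h.1, h.2.1⟩
    · have hpos : 0 < A.rank := hAr ▸ hr.pos
      obtain ⟨z, hz, h⟩ := exists_isCongr_typeDiagonal hF hs hpos
      refine (quadraticChar_dichotomy hz).imp (fun ht => ?_) fun ht => ?_ <;>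
        exact ⟨hs, hAr, (hasType_iff hpos _).2 ⟨z, ht, h⟩⟩
  · rw [Set.disjoint_left]
    rintro A ⟨-, hAr, ht⟩ ⟨-, -, ht'⟩
    have hpos : 0 < A.rank := hAr ▸ hr.pos
    obtain ⟨z, hz, h⟩ := (hasType_iff hpos _).1 ht
    obtain ⟨z', hz', h'⟩ := (hasType_iff hpos _).1 ht'
    have hz0 : z' ≠ 0 := by
      rintro rfl
      simp at hz'
    have := quadraticChar_eq_of_isCongr_smul (c := 1) (hAr ▸ hr) A.rank_le_width hz0
      (by simpa using h.symm.trans h')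
    rw [hz, hz'] at this
    simp at this

end Count

/-- Let `q` be an odd prime power. The number of `m × m` symmetric
matrices over `F_q` of rank `2s+1` and type `τ` equals
`(1/(2q^s)) · ∏_{j=0}^{2s}(q^m - q^j) / ∏_{j=0}^{s-1}(q^{2s} - q^{2j})`
(stated here with denominators cleared); in particular the count is independent of `τ`. -/
theorem count_symmetric_matrices_odd_rank (q m s : ℕ) (τ : ℤ)
    (F : Type*) [Field F] [Fintype F] [DecidableEq F]
    (hq : Fintype.card F = q) (hodd : Odd q) (hτ : τ = 1 ∨ τ = -1) (hs : 2 * s + 1 ≤ m) :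
    2 * (q : ℤ) ^ s * (∏ j ∈ Finset.range s, ((q : ℤ) ^ (2 * s) - (q : ℤ) ^ (2 * j))) *
        (Set.ncard {A : Matrix (Fin m) (Fin m) F |
            A.IsSymm ∧ A.rank = 2 * s + 1 ∧ HasType F A τ} : ℤ)
      = ∏ j ∈ Finset.range (2 * s + 1), ((q : ℤ) ^ m - (q : ℤ) ^ j) := by
  subst hq
  have hr : Odd (2 * s + 1) := odd_two_mul_add_one s
  have hadd := ncard_symmRankTypeSet_add (n := m) hodd hr
  have hneg := ncard_symmRankTypeSet_neg (n := m) hodd hr 1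
  have htwo : 2 * (symmRankTypeSet F m (2 * s + 1) τ).ncard =
      symmRankCount F (Fin m) (2 * s + 1) := by
    rcases hτ with rfl | rfl <;> omega
  have hcount := (symmRankCount_mul_evenProd F m s).2
  rw [← htwo] at hcount
  rw [← hcount, evenProd, symmRankTypeSet]
  push_cast
  ring
end
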